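/- The S-Heun operators on the discrete linear grid, L = ½(T₊−T₋), M₁ = ½(T₊+T₋), M₂ = ½x(T₊−T₋), R₁ = ½x[(1−2x)T₊+(1+2x)T₋], R₂ = ½x(T₊+T₋), satisfy, as operators on all functions f : ℝ → ℝ, the fourteen homogeneous quadratic reordering relations: M₁L = LM₁; M₂L = LM₂ − LM₁; M₂M₁ = M₁M₂ − L²; M₁² = 1 + L²; LR₁ = 1 − 2M₂² − M₁M₂; LR₂ = 1 + M₁M₂; R₁L = 3M₁M₂ − 3L² − 2M₂²; R₂L = M₁M₂ − L²; R₂R₁ = 2R₂² + R₁R₂ − 4M₂²; R₁M₁ = 3M₁R₂ − 2M₂R₂ − 3LM₁; R₁M₂ = 2M₂R₂ − 3M₁R₂ + 3LM₂ + M₂R₁; R₂M₁ = M₁R₂ − LM₁; R₂M₂ = M₂R₂ − M₁R₂ + LM₂; M₁R₁ = 3M₁R₂ − 2M₂R₂ − 4LM₂. -/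

import Mathlib

/-- Lowering S-Heun operator `L = ½(T₊ − T₋)` on the discrete linear grid. -/
noncomputable def opL (f : ℝ → ℝ) : ℝ → ℝ := fun x => (f (x+1) - f (x-1)) / 2
/-- Stabilizing S-Heun operator `M₁ = ½(T₊ + T₋)`. -/
noncomputable def opM1 (f : ℝ → ℝ) : ℝ → ℝ := fun x => (f (x+1) + f (x-1)) / 2
/-- Stabilizing S-Heun operator `M₂ = ½ x (T₊ − T₋)`. -/
noncomputable def opM2 (f : ℝ → ℝ) : ℝ → ℝ := fun x => x * (f (x+1) - f (x-1)) / 2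
/-- Raising S-Heun operator `R₁ = ½ x [(1−2x)T₊ + (1+2x)T₋]`. -/
noncomputable def opR1 (f : ℝ → ℝ) : ℝ → ℝ :=
  fun x => x * ((1 - 2*x) * f (x+1) + (1 + 2*x) * f (x-1)) / 2
/-- Raising S-Heun operator `R₂ = ½ x (T₊ + T₋)`. -/
noncomputable def opR2 (f : ℝ → ℝ) : ℝ → ℝ := fun x => x * (f (x+1) + f (x-1)) / 2

/-- The fourteen homogeneous quadratic reordering relations between the S-Heun
operators on the discrete linear grid. -/
theorem stmt_18 :
    (∀ (f : ℝ → ℝ) (x : ℝ), opM1 (opL f) x = opL (opM1 f) x) ∧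
    (∀ (f : ℝ → ℝ) (x : ℝ), opM2 (opL f) x = opL (opM2 f) x - opL (opM1 f) x) ∧
    (∀ (f : ℝ → ℝ) (x : ℝ), opM2 (opM1 f) x = opM1 (opM2 f) x - opL (opL f) x) ∧
    (∀ (f : ℝ → ℝ) (x : ℝ), opM1 (opM1 f) x = f x + opL (opL f) x) ∧
    (∀ (f : ℝ → ℝ) (x : ℝ), opL (opR1 f) x
        = f x - 2 * opM2 (opM2 f) x - opM1 (opM2 f) x) ∧
    (∀ (f : ℝ → ℝ) (x : ℝ), opL (opR2 f) x = f x + opM1 (opM2 f) x) ∧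
    (∀ (f : ℝ → ℝ) (x : ℝ), opR1 (opL f) x
        = 3 * opM1 (opM2 f) x - 3 * opL (opL f) x - 2 * opM2 (opM2 f) x) ∧
    (∀ (f : ℝ → ℝ) (x : ℝ), opR2 (opL f) x = opM1 (opM2 f) x - opL (opL f) x) ∧
    (∀ (f : ℝ → ℝ) (x : ℝ), opR2 (opR1 f) x
        = 2 * opR2 (opR2 f) x + opR1 (opR2 f) x - 4 * opM2 (opM2 f) x) ∧
    (∀ (f : ℝ → ℝ) (x : ℝ), opR1 (opM1 f) x
        = 3 * opM1 (opR2 f) x - 2 * opM2 (opR2 f) x - 3 * opL (opM1 f) x) ∧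
    (∀ (f : ℝ → ℝ) (x : ℝ), opR1 (opM2 f) x
        = 2 * opM2 (opR2 f) x - 3 * opM1 (opR2 f) x + 3 * opL (opM2 f) x
          + opM2 (opR1 f) x) ∧
    (∀ (f : ℝ → ℝ) (x : ℝ), opR2 (opM1 f) x = opM1 (opR2 f) x - opL (opM1 f) x) ∧
    (∀ (f : ℝ → ℝ) (x : ℝ), opR2 (opM2 f) x
        = opM2 (opR2 f) x - opM1 (opR2 f) x + opL (opM2 f) x) ∧
    (∀ (f : ℝ → ℝ) (x : ℝ), opM1 (opR1 f) x
        = 3 * opM1 (opR2 f) x - 2 * opM2 (opR2 f) x - 4 * opL (opM2 f) x) := by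
  refine ⟨?_, ?_, ?_, ?_, ?_, ?_, ?_, ?_, ?_, ?_, ?_, ?_, ?_, ?_⟩ <;> intro f x <;>
    have h1 : x + 1 + 1 = x + 2 := by ring
  all_goals
    have h2 : x - 1 - 1 = x - 2 := by ring
    have h3 : x + 1 - 1 = x := by ring
    have h4 : x - 1 + 1 = x := by ring
    simp only [opL, opM1, opM2, opR1, opR2, h1, h2, h3, h4]
    ring
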